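/- arXiv:1912.01492 — 3 statements merged into one kernel-verified Lean document; each statement's English description precedes it below -/
import Mathlib

section
/- Let T be a bounded linear operator on a nontrivial complex Hilbert space H and let α, β ≥ 0 with α + β ≥ 1. Then w²(T|T|^{α+β−1}) ≤ (1/4) ‖ |T|^{2α} + |T*|^{2β} ‖² − (1/4) · inf_{‖x‖=1} ( ⟨|T|^{2α}x, x⟩ − ⟨|T*|^{2β}x, x⟩ )². -/
open scoped InnerProductSpace NNReal

variable {H : Type*} [NormedAddCommGroup H] [InnerProductSpace ℂ H] [CompleteSpace H]

/-- The numerical radius `w(T) = sup { |⟨Tx, x⟩| : ‖x‖ = 1 }`. -/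
noncomputable def numRadius (T : H →L[ℂ] H) : ℝ :=
  ⨆ x : {x : H // ‖x‖ = 1}, ‖⟪T x.1, x.1⟫_ℂ‖

/-- The absolute value `|T| = (T*T)^(1/2)`. -/
noncomputable def opAbs (T : H →L[ℂ] H) : H →L[ℂ] H :=
  CFC.sqrt (star T * T)

/-- The real power `|T|^s` of the absolute value, via the continuous functional calculus. -/
noncomputable def opAbsPow (T : H →L[ℂ] H) (s : ℝ) : H →L[ℂ] H :=
  CFC.rpow (opAbs T) s

open Polynomial in
/-- An operator intertwining two self-adjoint operators intertwines their continuous functional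
calculi. -/
lemma mul_cfc_eq_cfc_mul {X A B : H →L[ℂ] H} (hA : IsSelfAdjoint A) (hB : IsSelfAdjoint B)
    (h : X * A = B * X) {f : ℝ → ℝ} (hf : Continuous f) :
    X * cfc f A = cfc f B * X := by
  rcases subsingleton_or_nontrivial H with hH | hH
  · ext x
    exact Subsingleton.elim _ _
  have hpoly (p : ℝ[X]) : X * aeval A p = aeval B p * X := by
    induction p using Polynomial.induction_on' with
    | add p q hp hq => simp only [map_add, mul_add, add_mul, hp, hq]
    | monomial n r =>
      have hn : X * A ^ n = B ^ n * X := SemiconjBy.pow_right h n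
      rw [aeval_monomial, aeval_monomial, Algebra.algebraMap_eq_smul_one, smul_mul_assoc,
        smul_mul_assoc, one_mul, one_mul, mul_smul_comm, hn, smul_mul_assoc]
  have hclose : ∀ ε > 0, ‖X * cfc f A - cfc f B * X‖ ≤ ε * (2 * ‖X‖) := by
    intro ε hε
    set M := max ‖A‖ ‖B‖
    obtain ⟨p, hp⟩ := exists_polynomial_near_of_continuousOn (-M) M f hf.continuousOn ε hε
    have hnear : ∀ C : H →L[ℂ] H, IsSelfAdjoint C → ‖C‖ ≤ M → ‖cfc f C - aeval C p‖ ≤ ε := by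
      intro C hC hCM
      rw [← cfc_polynomial p C hC, ← cfc_sub f p.eval C hf.continuousOn p.continuous.continuousOn]
      refine norm_cfc_le hε.le fun t ht => ?_
      rw [norm_sub_rev]
      exact (hp t (abs_le.mp ((spectrum.norm_le_norm_of_mem ht).trans hCM))).le
    have hAp := hnear A hA (le_max_left _ _)
    have hBp := hnear B hB (le_max_right _ _)
    have hsplit : X * cfc f A - cfc f B * X
        = X * (cfc f A - aeval A p) - (cfc f B - aeval B p) * X := by
      rw [mul_sub, sub_mul, hpoly]
      abel
    rw [hsplit]
    calc _ ≤ ‖X‖ * ‖cfc f A - aeval A p‖ + ‖cfc f B - aeval B p‖ * ‖X‖ :=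
          (norm_sub_le _ _).trans (add_le_add (norm_mul_le _ _) (norm_mul_le _ _))
      _ ≤ ‖X‖ * ε + ε * ‖X‖ := by gcongr
      _ = ε * (2 * ‖X‖) := by ring
  have hzero : ‖X * cfc f A - cfc f B * X‖ ≤ 0 := by
    refine le_of_forall_pos_le_add fun δ hδ => ?_
    refine (hclose (δ / (2 * ‖X‖ + 1)) (by positivity)).trans ?_
    rw [zero_add, div_mul_eq_mul_div, div_le_iff₀ (by positivity)]
    nlinarith
  exact sub_eq_zero.mp (norm_le_zero_iff.mp hzero)

lemma opAbsPow_eq_cfc (T : H →L[ℂ] H) {s : ℝ} (hs : 0 ≤ s) :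
    opAbsPow T s = cfc (fun t : ℝ => (√t) ^ s) (star T * T) := by
  have hpos : 0 ≤ star T * T := star_mul_self_nonneg T
  have hsa : IsSelfAdjoint (star T * T) := IsSelfAdjoint.star_mul_self T
  have habs : opAbs T = cfc Real.sqrt (star T * T) := by
    rw [opAbs, CFC.sqrt_eq_real_sqrt _ hpos, cfcₙ_eq_cfc]
  have habs_nonneg : 0 ≤ opAbs T := CFC.sqrt_nonneg _
  rw [opAbsPow, CFC.rpow_eq_pow, CFC.rpow_eq_cfc_real habs_nonneg, habs]
  exact (cfc_comp' (fun x : ℝ => x ^ s) Real.sqrt (star T * T)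
    (Real.continuous_rpow_const hs).continuousOn Real.continuous_sqrt.continuousOn hsa).symm

lemma re_inner_star_mul_self (S : H →L[ℂ] H) (x : H) :
    (⟪(star S * S) x, x⟫_ℂ).re = ‖S x‖ ^ 2 := by
  rw [mul_apply_eq_comp, ContinuousLinearMap.star_eq_adjoint,
    ContinuousLinearMap.adjoint_inner_left, inner_self_eq_norm_sq_to_K]
  norm_cast

lemma re_inner_cfc_mul_self (A : H →L[ℂ] H) {f : ℝ → ℝ} (hf : Continuous f) (x : H) :
    (⟪cfc (fun t => f t * f t) A x, x⟫_ℂ).re = ‖cfc f A x‖ ^ 2 := by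
  have hsa : IsSelfAdjoint (cfc f A) := cfc_predicate f A
  rw [← re_inner_star_mul_self, hsa.star_eq, cfc_mul f f A hf.continuousOn hf.continuousOn]

lemma norm_mul_cfc_star_mul_self_le (T : H →L[ℂ] H) {k : ℝ → ℝ} (hk : Continuous k) {c : ℝ}
    (hc : 0 ≤ c) (h : ∀ t, 0 ≤ t → t ≤ ‖T‖ ^ 2 → √t * |k t| ≤ c) :
    ‖T * cfc k (star T * T)‖ ≤ c := by
  rcases subsingleton_or_nontrivial H with hH | hH
  · rwa [show T * cfc k (star T * T) = 0 from by ext x; exact Subsingleton.elim _ _, norm_zero]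
  set A := star T * T with hA
  have hpos : 0 ≤ A := star_mul_self_nonneg T
  have hsa : IsSelfAdjoint A := IsSelfAdjoint.star_mul_self T
  have hksa : IsSelfAdjoint (cfc k A) := cfc_predicate k A
  have hprod : star (T * cfc k A) * (T * cfc k A) = cfc (fun t => k t * t * k t) A := by
    rw [cfc_mul (fun t => k t * t) k A (by fun_prop) (by fun_prop),
      cfc_mul k (fun t => t) A (by fun_prop) (by fun_prop), cfc_id' ℝ A hsa, star_mul,
      hksa.star_eq, hA]
    simp only [mul_assoc]
  have hsq : ‖T * cfc k A‖ * ‖T * cfc k A‖ ≤ c * c := by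
    rw [← CStarRing.norm_star_mul_self, hprod]
    refine norm_cfc_le (by positivity) fun t ht => ?_
    have ht0 : 0 ≤ t := spectrum_nonneg_of_nonneg hpos ht
    have htn : t ≤ ‖T‖ ^ 2 := by
      have := (le_abs_self t).trans (spectrum.norm_le_norm_of_mem ht)
      rwa [hA, CStarRing.norm_star_mul_self, ← sq] at this
    have hb := h t ht0 htn
    have hid : ‖k t * t * k t‖ = (√t * |k t|) * (√t * |k t|) := by
      rw [Real.norm_eq_abs, abs_mul, abs_mul, abs_of_nonneg ht0]
      linear_combination -|k t| * |k t| * Real.mul_self_sqrt ht0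
    rw [hid]
    exact mul_self_le_mul_self (by positivity) hb
  exact abs_le_of_sq_le_sq' (by simpa [sq] using hsq) hc |>.2

/-- Furuta's mixed Schwarz inequality. -/
lemma norm_inner_mul_opAbsPow_sq_le (T : H →L[ℂ] H) {α β : ℝ} (hα : 0 ≤ α) (hβ : 0 ≤ β)
    (hαβ : 1 ≤ α + β) (x y : H) :
    ‖⟪(T * opAbsPow T (α + β - 1)) x, y⟫_ℂ‖ ^ 2 ≤
      (⟪opAbsPow T (2 * α) x, x⟫_ℂ).re * (⟪opAbsPow (star T) (2 * β) y, y⟫_ℂ).re := by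
  set A := star T * T with hA
  set B := T * star T with hB
  have hAsa : IsSelfAdjoint A := IsSelfAdjoint.star_mul_self T
  have hBsa : IsSelfAdjoint B := IsSelfAdjoint.mul_star_self T
  have hBpos : 0 ≤ B := mul_star_self_nonneg T
  have hpow {s : ℝ} (hs : 0 ≤ s) : Continuous fun t : ℝ => (√t) ^ s :=
    Real.continuous_sqrt.rpow_const fun _ => Or.inr hs
  have hγ : 0 ≤ α + β - 1 := by linarith
  have hdouble {s : ℝ} (hs : 0 ≤ s) (t : ℝ) : (√t) ^ (2 * s) = (√t) ^ s * (√t) ^ s := by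
    rw [two_mul, Real.rpow_add_of_nonneg (Real.sqrt_nonneg t) hs hs]
  have ha : (⟪opAbsPow T (2 * α) x, x⟫_ℂ).re = ‖cfc (fun t : ℝ => (√t) ^ α) A x‖ ^ 2 := by
    rw [opAbsPow_eq_cfc T (by positivity), ← re_inner_cfc_mul_self A (hpow hα)]
    simp only [hdouble hα, hA]
  have hb : (⟪opAbsPow (star T) (2 * β) y, y⟫_ℂ).re = ‖cfc (fun t : ℝ => (√t) ^ β) B y‖ ^ 2 := by
    rw [opAbsPow_eq_cfc (star T) (by positivity), ← re_inner_cfc_mul_self B (hpow hβ)]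
    simp only [hdouble hβ, hB, star_star]
  set a := ‖cfc (fun t : ℝ => (√t) ^ α) A x‖
  set b := ‖cfc (fun t : ℝ => (√t) ^ β) B y‖
  rw [ha, hb, ← mul_pow]
  refine pow_le_pow_left₀ (norm_nonneg _) ?_ 2
  rw [opAbsPow_eq_cfc T hγ, ← hA]
  set c := ‖T‖ ^ (α + β - 1)
  have hc0 : 0 ≤ c := by positivity
  have happrox : ∀ ε > 0, ‖⟪(T * cfc (fun t : ℝ => (√t) ^ (α + β - 1)) A) x, y⟫_ℂ‖
      ≤ a * b + ε * (c * ‖x‖ * ‖y‖) := by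
    intro ε hε
    set g : ℝ → ℝ := fun t => (√t) ^ β / (√t + ε) with hg
    have hgc : Continuous g :=
      (hpow hβ).div (by fun_prop) fun t => by positivity
    have hfgc : Continuous fun t : ℝ => g t * (√t) ^ α := hgc.mul (hpow hα)
    have herr : ‖T * cfc (fun t : ℝ => (√t) ^ (α + β - 1) - g t * (√t) ^ α) A‖ ≤ ε * c := by
      refine norm_mul_cfc_star_mul_self_le T ((hpow hγ).sub hfgc) (by positivity)
        fun t ht htn => ?_
      have hr : 0 ≤ √t := Real.sqrt_nonneg t
      have hrT : √t ≤ ‖T‖ := Real.sqrt_le_iff.mpr ⟨norm_nonneg _, htn⟩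
      have hrc : (√t) ^ (α + β - 1) ≤ c := Real.rpow_le_rpow hr hrT hγ
      have hmul : √t * (√t) ^ (α + β - 1) = (√t) ^ β * (√t) ^ α := by
        rw [← Real.rpow_add_of_nonneg hr hβ hα]
        nth_rewrite 1 [← Real.rpow_one (√t)]
        rw [← Real.rpow_add_of_nonneg hr zero_le_one hγ]
        congr 1
        ring
      have hid : √t * ((√t) ^ (α + β - 1) - g t * (√t) ^ α)
          = ε * (√t) ^ (α + β - 1) * (√t / (√t + ε)) := by
        have hne : √t + ε ≠ 0 := by positivity
        simp only [hg]
        field_simp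
        linear_combination √t * hmul
      have hfrac : √t / (√t + ε) ≤ 1 := by
        rw [div_le_one (by positivity)]
        linarith
      change √t * |(√t) ^ (α + β - 1) - g t * (√t) ^ α| ≤ ε * c
      have habs : √t * |(√t) ^ (α + β - 1) - g t * (√t) ^ α|
          = ε * (√t) ^ (α + β - 1) * (√t / (√t + ε)) := by
        rw [← abs_of_nonneg (show 0 ≤ ε * (√t) ^ (α + β - 1) * (√t / (√t + ε)) by positivity),
          ← hid, abs_mul, abs_of_nonneg hr]
      rw [habs]
      calc _ ≤ ε * (√t) ^ (α + β - 1) * 1 := by gcongr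
        _ ≤ ε * c := by rw [mul_one]; gcongr
    have hgsa : star (cfc g A) = cfc g A := (cfc_predicate g A : IsSelfAdjoint _).star_eq
    have hmain : ‖cfc g A (star T y)‖ ≤ b := by
      have hcomm : star T * cfc g B = cfc g A * star T :=
        mul_cfc_eq_cfc_mul hBsa hAsa (by simp only [hA, hB, mul_assoc]) hgc
      rw [show cfc g A (star T y) = (star T * cfc g B) y by rw [hcomm]; rfl]
      have hsq : ‖(star T * cfc g B) y‖ ^ 2 ≤ b ^ 2 := by
        have hgBsa : star (cfc g B) = cfc g B := (cfc_predicate g B : IsSelfAdjoint _).star_eq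
        have hprod : star (star T * cfc g B) * (star T * cfc g B)
            = cfc (fun t => g t * t * g t) B := by
          rw [cfc_mul (fun t => g t * t) g B (by fun_prop) (by fun_prop),
            cfc_mul g (fun t => t) B (by fun_prop) (by fun_prop), cfc_id' ℝ B hBsa, star_mul,
            hgBsa, star_star, hB]
          simp only [mul_assoc]
        have hle : cfc (fun t => g t * t * g t) B ≤
            cfc (fun t : ℝ => (√t) ^ β * (√t) ^ β) B := by
          refine cfc_mono (fun t ht => ?_) (by fun_prop)
            ((hpow hβ).mul (hpow hβ)).continuousOn
          have ht0 : 0 ≤ t := spectrum_nonneg_of_nonneg hBpos ht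
          have hr : 0 ≤ √t := Real.sqrt_nonneg t
          have hle : √t * g t ≤ (√t) ^ β := by
            simp only [hg]
            rw [← mul_div_assoc, div_le_iff₀ (by positivity)]
            nlinarith [Real.rpow_nonneg hr β]
          calc g t * t * g t = (√t * g t) * (√t * g t) := by
                linear_combination -g t * g t * Real.mul_self_sqrt ht0
            _ ≤ _ := mul_self_le_mul_self (by positivity) hle
        have hre := ((ContinuousLinearMap.le_def _ _).mp hle).re_inner_nonneg_left y
        rw [sub_apply, inner_sub_left, map_sub, sub_nonneg, ← hprod] at hre
        calc ‖(star T * cfc g B) y‖ ^ 2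
            = (⟪(star (star T * cfc g B) * (star T * cfc g B)) y, y⟫_ℂ).re :=
              (re_inner_star_mul_self _ y).symm
          _ ≤ _ := hre
          _ = b ^ 2 := re_inner_cfc_mul_self B (hpow hβ) y
      exact abs_le_of_sq_le_sq' hsq (norm_nonneg _) |>.2
    have hsplit : T * cfc (fun t : ℝ => (√t) ^ (α + β - 1)) A
        = T * cfc g A * cfc (fun t : ℝ => (√t) ^ α) A
          + T * cfc (fun t : ℝ => (√t) ^ (α + β - 1) - g t * (√t) ^ α) A := by
      rw [cfc_sub _ _ A (hpow hγ).continuousOn hfgc.continuousOn,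
        cfc_mul _ _ A hgc.continuousOn (hpow hα).continuousOn, mul_sub, mul_assoc]
      abel
    rw [hsplit, add_apply, inner_add_left]
    refine (norm_add_le _ _).trans (add_le_add ?_ ?_)
    · have hadj : ⟪(T * cfc g A * cfc (fun t : ℝ => (√t) ^ α) A) x, y⟫_ℂ
          = ⟪cfc (fun t : ℝ => (√t) ^ α) A x, cfc g A (star T y)⟫_ℂ := by
        rw [mul_apply_eq_comp, ← ContinuousLinearMap.adjoint_inner_right,
          ← ContinuousLinearMap.star_eq_adjoint, star_mul, hgsa]
        rfl
      rw [hadj]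
      exact (norm_inner_le_norm _ _).trans (by gcongr)
    · refine (norm_inner_le_norm _ _).trans ?_
      calc _ ≤ (ε * c * ‖x‖) * ‖y‖ := by
            gcongr
            exact ContinuousLinearMap.le_of_opNorm_le _ herr x
        _ = ε * (c * ‖x‖ * ‖y‖) := by ring
  refine le_of_forall_pos_le_add fun δ hδ => ?_
  set K := c * ‖x‖ * ‖y‖
  have hK0 : 0 ≤ K := by positivity
  refine (happrox (δ / (K + 1)) (by positivity)).trans ?_
  gcongr
  rw [div_mul_eq_mul_div, div_le_iff₀ (by positivity)]
  nlinarith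

theorem stmt2 [Nontrivial H] (T : H →L[ℂ] H) (α β : ℝ) (hα : 0 ≤ α) (hβ : 0 ≤ β)
    (hαβ : 1 ≤ α + β) :
    numRadius (T * opAbsPow T (α + β - 1)) ^ 2 ≤
      (1 / 4 : ℝ) * ‖opAbsPow T (2 * α) + opAbsPow (star T) (2 * β)‖ ^ 2 -
        (1 / 4 : ℝ) *
          ⨅ x : {x : H // ‖x‖ = 1},
            ((⟪(opAbsPow T (2 * α)) x.1, x.1⟫_ℂ).re -
              (⟪(opAbsPow (star T) (2 * β)) x.1, x.1⟫_ℂ).re) ^ 2 := by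
  obtain ⟨x₀, hx₀⟩ := exists_norm_eq H zero_le_one
  have : Nonempty {x : H // ‖x‖ = 1} := ⟨⟨x₀, hx₀⟩⟩
  set P := opAbsPow T (2 * α)
  set Q := opAbsPow (star T) (2 * β)
  set m := ⨅ x : {x : H // ‖x‖ = 1}, ((⟪P x.1, x.1⟫_ℂ).re - (⟪Q x.1, x.1⟫_ℂ).re) ^ 2
  have hpoint (x : {x : H // ‖x‖ = 1}) :
      ‖⟪(T * opAbsPow T (α + β - 1)) x.1, x.1⟫_ℂ‖ ^ 2 ≤
        (1 / 4 : ℝ) * ‖P + Q‖ ^ 2 - (1 / 4 : ℝ) * m := by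
    have hmixed := norm_inner_mul_opAbsPow_sq_le T hα hβ hαβ x.1 x.1
    have hm : m ≤ ((⟪P x.1, x.1⟫_ℂ).re - (⟪Q x.1, x.1⟫_ℂ).re) ^ 2 :=
      ciInf_le ⟨0, by rintro _ ⟨z, rfl⟩; exact sq_nonneg _⟩ x
    have hsum : |(⟪P x.1, x.1⟫_ℂ).re + (⟪Q x.1, x.1⟫_ℂ).re| ≤ ‖P + Q‖ := by
      rw [← Complex.add_re, ← inner_add_left, ← add_apply]
      refine (Complex.abs_re_le_norm _).trans ((norm_inner_le_norm _ _).trans ?_)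
      simpa [x.2] using (P + Q).le_opNorm x.1
    have hsq := sq_le_sq' (abs_le.mp hsum).1 (abs_le.mp hsum).2
    linarith
  have hrhs := (sq_nonneg _).trans (hpoint ⟨x₀, hx₀⟩)
  have hle : numRadius (T * opAbsPow T (α + β - 1)) ≤
      √((1 / 4 : ℝ) * ‖P + Q‖ ^ 2 - (1 / 4 : ℝ) * m) :=
    ciSup_le fun x => Real.le_sqrt_of_sq_le (hpoint x)
  exact (pow_le_pow_left₀ (Real.iSup_nonneg fun _ => norm_nonneg _) hle 2).trans_eq
    (Real.sq_sqrt hrhs)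
end

section
/- Let T be a bounded linear operator on a nontrivial complex Hilbert space H, let α, β ≥ 0 with α + β ≥ 1, and let s ≥ 1. Then w^{2s}(T|T|^{α+β−1}) ≤ (1/2) ‖ |T|^{4sα} + |T*|^{4sβ} ‖ − (1/2) · inf_{‖x‖=1} ( ⟨|T|^{2sα}x, x⟩ − ⟨|T*|^{2sβ}x, x⟩ )². -/
open scoped InnerProductSpace NNReal

variable {H : Type*} [NormedAddCommGroup H] [InnerProductSpace ℂ H] [CompleteSpace H]

section CFC

variable {A : Type*} [CStarAlgebra A]

/-- An element intertwining two self-adjoint elements also intertwines their images under the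
continuous functional calculus. -/
lemma SemiconjBy.cfc_real {x a b : A} (h : SemiconjBy x a b) (ha : IsSelfAdjoint a)
    (hb : IsSelfAdjoint b) {f : ℝ → ℝ} (hf : Continuous f) :
    SemiconjBy x (cfc f a) (cfc f b) := by
  have hpoly (p : Polynomial ℝ) : x * Polynomial.aeval a p = Polynomial.aeval b p * x := by
    induction p using Polynomial.induction_on' with
    | add p q hp hq => simp only [map_add, mul_add, add_mul, hp, hq]
    | monomial n r =>
      rw [Polynomial.aeval_monomial, Polynomial.aeval_monomial, ← mul_assoc,
        ← Algebra.commutes r x, mul_assoc, mul_assoc, (h.pow_right n).eq]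
  set M : ℝ := max (‖a‖ * ‖(1 : A)‖) (‖b‖ * ‖(1 : A)‖)
  have happrox {c : A} (hc : IsSelfAdjoint c) (hcM : ‖c‖ * ‖(1 : A)‖ ≤ M) {δ : ℝ} (hδ : 0 < δ)
      {p : Polynomial ℝ} (hp : ∀ t ∈ Set.Icc (-M) M, |p.eval t - f t| < δ) :
      ‖cfc f c - Polynomial.aeval c p‖ ≤ δ := by
    rw [← cfc_polynomial p c, ← cfc_sub f p.eval c]
    refine norm_cfc_le hδ.le fun t ht ↦ ?_
    rw [Real.norm_eq_abs, abs_sub_comm]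
    have ht' : |t| ≤ M := (spectrum.norm_le_norm_mul_of_mem ht).trans hcM
    exact (hp t (abs_le.mp ht')).le
  have hbound {δ : ℝ} (hδ : 0 < δ) : ‖x * cfc f a - cfc f b * x‖ ≤ δ * (2 * ‖x‖) := by
    obtain ⟨p, hp⟩ := exists_polynomial_near_of_continuousOn (-M) M f hf.continuousOn δ hδ
    have h1 := happrox ha (le_max_left _ _) hδ hp
    have h2 := happrox hb (le_max_right _ _) hδ hp
    calc ‖x * cfc f a - cfc f b * x‖
        = ‖x * (cfc f a - Polynomial.aeval a p) - (cfc f b - Polynomial.aeval b p) * x‖ := by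
          rw [mul_sub, sub_mul, hpoly, sub_sub_sub_cancel_right]
      _ ≤ ‖x‖ * δ + δ * ‖x‖ := by
          refine (norm_sub_le _ _).trans (add_le_add ?_ ?_)
          · exact (norm_mul_le _ _).trans (by gcongr)
          · exact (norm_mul_le _ _).trans (by gcongr)
      _ = δ * (2 * ‖x‖) := by ring
  refine sub_eq_zero.mp (norm_le_zero_iff.mp (le_of_forall_pos_le_add fun ε hε ↦ ?_))
  refine (hbound (δ := ε / (2 * ‖x‖ + 1)) (by positivity)).trans ?_
  rw [zero_add, div_mul_eq_mul_div, div_le_iff₀ (by positivity)]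
  nlinarith [norm_nonneg x]

variable [PartialOrder A] [StarOrderedRing A]

lemma SemiconjBy.cfc_rpow {x a b : A} (h : SemiconjBy x a b) (ha : 0 ≤ a) (hb : 0 ≤ b) {r : ℝ}
    (hr : 0 ≤ r) : SemiconjBy x (a ^ r) (b ^ r) := by
  rw [CFC.rpow_eq_cfc_real ha, CFC.rpow_eq_cfc_real hb]
  exact h.cfc_real (.of_nonneg ha) (.of_nonneg hb) (Real.continuous_rpow_const hr)

end CFC

section MixedSchwarz

lemma opAbs_nonneg (T : H →L[ℂ] H) : 0 ≤ opAbs T := CFC.sqrt_nonneg _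

lemma opAbsPow_eq_rpow (T : H →L[ℂ] H) (r : ℝ) : opAbsPow T r = opAbs T ^ r := rfl

lemma opAbsPow_nonneg (T : H →L[ℂ] H) (r : ℝ) : 0 ≤ opAbsPow T r := CFC.rpow_nonneg

lemma opAbs_mul_self (T : H →L[ℂ] H) : opAbs T * opAbs T = star T * T :=
  CFC.sqrt_mul_sqrt_self _ (star_mul_self_nonneg T)

lemma opAbsPow_rpow (T : H →L[ℂ] H) {r t : ℝ} (hr : 0 ≤ r) (ht : 0 ≤ t) :
    opAbsPow T r ^ t = opAbsPow T (r * t) :=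
  CFC.rpow_rpow_of_exponent_nonneg _ r t hr ht (opAbs_nonneg T)

lemma semiconjBy_opAbs (T : H →L[ℂ] H) : SemiconjBy T (opAbs T) (opAbs (star T)) := by
  have h : SemiconjBy T (star T * T) (star (star T) * star T) := by
    rw [star_star, SemiconjBy, mul_assoc]
  rw [opAbs, opAbs, CFC.sqrt_eq_rpow, CFC.sqrt_eq_rpow]
  exact h.cfc_rpow (star_mul_self_nonneg T) (star_mul_self_nonneg (star T)) (by norm_num)

lemma norm_mul_eq_norm_opAbs_mul (T R : H →L[ℂ] H) : ‖T * R‖ = ‖opAbs T * R‖ := by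
  have h : star (T * R) * (T * R) = star (opAbs T * R) * (opAbs T * R) := by
    rw [star_mul, star_mul, (IsSelfAdjoint.of_nonneg (opAbs_nonneg T)).star_eq]
    calc star R * star T * (T * R) = star R * (star T * T) * R := by simp only [mul_assoc]
      _ = star R * opAbs T * (opAbs T * R) := by
        rw [← opAbs_mul_self]; simp only [mul_assoc]
  have h2 := congrArg norm h
  rw [CStarRing.norm_star_mul_self, CStarRing.norm_star_mul_self] at h2
  exact (mul_self_inj (norm_nonneg _) (norm_nonneg _)).mp h2

lemma inner_apply_comm_of_nonneg {E : Type*} [NormedAddCommGroup E] [InnerProductSpace ℂ E]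
    {S : E →L[ℂ] E} (hS : 0 ≤ S) (x y : E) :
    ⟪S x, y⟫_ℂ = ⟪x, S y⟫_ℂ :=
  ((ContinuousLinearMap.nonneg_iff_isPositive S).mp hS).inner_left_eq_inner_right x y

/-- Furuta's generalization of the mixed Schwarz inequality. -/
lemma norm_inner_mul_opAbsPow_le (T : H →L[ℂ] H) {α β : ℝ} (hα : 0 ≤ α) (hβ : 0 ≤ β)
    (hαβ : 1 ≤ α + β) (x y : H) :
    ‖⟪(T * opAbsPow T (α + β - 1)) x, y⟫_ℂ‖ ≤ ‖opAbsPow T α x‖ * ‖opAbsPow (star T) β y‖ := by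
  set γ := α + β - 1 with hγ_def
  have hγ : 0 ≤ γ := by linarith
  have hA : 0 ≤ opAbs T := opAbs_nonneg T
  have hspec {t : ℝ} (ht : t ∈ spectrum ℝ (opAbs T)) : 0 ≤ t := spectrum_nonneg_of_nonneg hA ht
  have hbound {ε : ℝ} (hε : 0 < ε) : ‖⟪(T * opAbsPow T γ) x, y⟫_ℂ‖ ≤
      ‖opAbsPow T α x‖ * ‖opAbsPow (star T) β y‖ + ε * (‖opAbsPow T γ x‖ * ‖y‖) := by
    have hpos {t : ℝ} (ht : t ∈ spectrum ℝ (opAbs T)) : 0 < t + ε := by linarith [hspec ht]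
    have hcont : ContinuousOn (fun t : ℝ ↦ (t + ε)⁻¹) (spectrum ℝ (opAbs T)) :=
      ContinuousOn.inv₀ (by fun_prop) fun t ht ↦ (hpos ht).ne'
    have hcpow {r : ℝ} (hr : 0 ≤ r) :
        ContinuousOn (fun t : ℝ ↦ t ^ r) (spectrum ℝ (opAbs T)) :=
      (Real.continuous_rpow_const hr).continuousOn
    set R := cfc (fun t : ℝ ↦ (t + ε)⁻¹) (opAbs T) with hR
    have hcontr : ‖T * R‖ ≤ 1 := by
      rw [norm_mul_eq_norm_opAbs_mul, hR]
      nth_rewrite 1 [← cfc_id' ℝ (opAbs T)]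
      rw [← cfc_mul _ _ _ (continuousOn_id' _) hcont]
      refine norm_cfc_le zero_le_one fun t ht ↦ ?_
      rw [Real.norm_of_nonneg (mul_nonneg (hspec ht) (inv_nonneg.mpr (hpos ht).le)),
        ← div_eq_mul_inv, div_le_one (hpos ht)]
      linarith
    have hαβcont : ContinuousOn (fun t : ℝ ↦ t ^ β * t ^ α) (spectrum ℝ (opAbs T)) :=
      (hcpow hβ).mul (hcpow hα)
    have hγcont : ContinuousOn (fun t : ℝ ↦ (t + ε)⁻¹ * t ^ γ) (spectrum ℝ (opAbs T)) :=
      hcont.mul (hcpow hγ)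
    have hdecomp : opAbsPow T γ =
        R * (opAbsPow T β * opAbsPow T α) + ε • (R * opAbsPow T γ) := by
      simp only [opAbsPow_eq_rpow, CFC.rpow_eq_cfc_real hA, hR]
      rw [← cfc_mul _ _ _ (hcpow hβ) (hcpow hα),
        ← cfc_mul _ _ _ hcont hαβcont,
        ← cfc_mul _ _ _ hcont (hcpow hγ),
        ← cfc_smul ε _ _ hγcont,
        ← cfc_add (opAbs T) (fun t ↦ (t + ε)⁻¹ * (t ^ β * t ^ α)) (fun t ↦ ε • ((t + ε)⁻¹ * t ^ γ))
          (hcont.mul hαβcont) (hγcont.const_smul ε)]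
      refine cfc_congr fun t ht ↦ ?_
      have h1 : t ^ β * t ^ α = t ^ γ * t := by
        rw [← Real.rpow_add_of_nonneg (hspec ht) hβ hα]
        nth_rewrite 3 [← Real.rpow_one t]
        rw [← Real.rpow_add_of_nonneg (hspec ht) hγ zero_le_one]
        congr 1
        rw [hγ_def]; ring
      have h2 := (hpos ht).ne'
      simp only [h1, smul_eq_mul]
      field_simp
    have hcomm : R * opAbsPow T β = opAbsPow T β * R := by
      rw [opAbsPow_eq_rpow, CFC.rpow_eq_cfc_real hA]
      exact cfc_commute_cfc _ _ _
    have hsemi : T * opAbsPow T β = opAbsPow (star T) β * T :=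
      ((semiconjBy_opAbs T).cfc_rpow hA (opAbs_nonneg _) hβ).eq
    have hfactor : T * opAbsPow T γ =
        opAbsPow (star T) β * (T * R) * opAbsPow T α + ε • (T * R * opAbsPow T γ) := by
      nth_rewrite 1 [hdecomp]
      rw [mul_add, mul_smul_comm, ← mul_assoc R, hcomm]
      simp only [← mul_assoc]
      rw [hsemi]
    have hV (z : H) : ‖(T * R) z‖ ≤ ‖z‖ := by
      simpa using (T * R).le_of_opNorm_le hcontr z
    rw [hfactor]
    calc ‖⟪(opAbsPow (star T) β * (T * R) * opAbsPow T α + ε • (T * R * opAbsPow T γ)) x, y⟫_ℂ‖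
        = ‖⟪(T * R) (opAbsPow T α x), opAbsPow (star T) β y⟫_ℂ +
            ⟪ε • (T * R) (opAbsPow T γ x), y⟫_ℂ‖ := by
          rw [← inner_apply_comm_of_nonneg (opAbsPow_nonneg _ _), ← inner_add_left]
          rfl
      _ ≤ ‖(T * R) (opAbsPow T α x)‖ * ‖opAbsPow (star T) β y‖ +
            ‖ε • (T * R) (opAbsPow T γ x)‖ * ‖y‖ :=
          (norm_add_le _ _).trans (add_le_add (norm_inner_le_norm _ _) (norm_inner_le_norm _ _))
      _ ≤ _ := by
          rw [norm_smul, Real.norm_of_nonneg hε.le, mul_assoc]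
          gcongr <;> exact hV _
  refine le_of_forall_pos_le_add fun ε hε ↦ ?_
  have hK : 0 ≤ ‖opAbsPow T γ x‖ * ‖y‖ := by positivity
  refine (hbound (ε := ε / (‖opAbsPow T γ x‖ * ‖y‖ + 1)) (by positivity)).trans ?_
  gcongr
  rw [div_mul_eq_mul_div, div_le_iff₀ (by positivity)]
  nlinarith

end MixedSchwarz

section HolderMcCarthy

/-- The tangent line inequality for `t ↦ t ^ r` at `c`. -/
lemma Real.mul_rpow_sub_one_mul_le {r : ℝ} (hr : 1 ≤ r) {c t : ℝ} (hc : 0 ≤ c) (ht : 0 ≤ t) :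
    r * c ^ (r - 1) * t - (r - 1) * c ^ r ≤ t ^ r := by
  have hr0 : 0 < r := by linarith
  have h := Real.geom_mean_le_arith_mean2_weighted (w₁ := 1 / r) (w₂ := 1 - 1 / r)
    (p₁ := t ^ r) (p₂ := c ^ r) (by positivity)
    (sub_nonneg.mpr ((div_le_one hr0).mpr hr)) (by positivity) (by positivity) (by ring)
  rw [← Real.rpow_mul ht, ← Real.rpow_mul hc, mul_one_div_cancel hr0.ne', Real.rpow_one,
    show r * (1 - 1 / r) = r - 1 by field_simp] at h
  have h2 := mul_le_mul_of_nonneg_left h hr0.le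
  rw [show r * (1 / r * t ^ r + (1 - 1 / r) * c ^ r) = t ^ r + (r - 1) * c ^ r by
    field_simp] at h2
  linarith

/-- The Hölder–McCarthy inequality. -/
lemma re_inner_rpow_le {S : H →L[ℂ] H} (hS : 0 ≤ S) {r : ℝ} (hr : 1 ≤ r) {x : H}
    (hx : ‖x‖ = 1) : (⟪S x, x⟫_ℂ).re ^ r ≤ (⟪(S ^ r) x, x⟫_ℂ).re := by
  set c := (⟪S x, x⟫_ℂ).re with hc_def
  have hc : 0 ≤ c := ((ContinuousLinearMap.nonneg_iff_isPositive S).mp hS).re_inner_nonneg_left x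
  have hle : (r * c ^ (r - 1)) • S - algebraMap ℝ (H →L[ℂ] H) ((r - 1) * c ^ r) ≤ S ^ r := by
    rw [CFC.rpow_eq_cfc_real hS, ← cfc_const _ S (.of_nonneg hS)]
    nth_rewrite 1 [← cfc_id' ℝ S]
    have hcr : Continuous fun t : ℝ ↦ t ^ r := Real.continuous_rpow_const (by linarith)
    rw [← cfc_smul _ _ _, ← cfc_sub _ _ _]
    refine cfc_mono (fun t ht ↦ ?_) (by fun_prop) hcr.continuousOn
    exact Real.mul_rpow_sub_one_mul_le hr hc (spectrum_nonneg_of_nonneg hS ht)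
  have h := ((ContinuousLinearMap.le_def _ _).mp hle).re_inner_nonneg_left x
  have hxx : ⟪x, x⟫_ℂ = 1 := by simp [inner_self_eq_norm_sq_to_K, hx]
  have hcc : c ^ (r - 1) * c = c ^ r := by
    nth_rewrite 2 [← Real.rpow_one c]
    rw [← Real.rpow_add_of_nonneg hc (by linarith) zero_le_one, sub_add_cancel]
  simp only [Algebra.algebraMap_eq_smul_one, sub_apply,
    smul_apply, one_apply_eq_self, inner_sub_left,
    inner_smul_left_eq_smul, hxx, Complex.sub_re, Complex.real_smul,
    Complex.re_ofReal_mul, Complex.one_re, RCLike.re_eq_complex_re, ← hc_def] at h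
  nlinarith

end HolderMcCarthy

lemma norm_opAbsPow_apply_sq (T : H →L[ℂ] H) {r : ℝ} (hr : 0 ≤ r) (x : H) :
    ‖opAbsPow T r x‖ ^ 2 = (⟪opAbsPow T (2 * r) x, x⟫_ℂ).re := by
  have h : opAbsPow T (2 * r) = opAbsPow T r * opAbsPow T r := by
    rw [mul_comm, ← opAbsPow_rpow T hr zero_le_two, ← pow_two]
    exact_mod_cast CFC.rpow_natCast (opAbsPow T r) 2 (opAbsPow_nonneg T r)
  rw [h, mul_apply_eq_comp, inner_apply_comm_of_nonneg (opAbsPow_nonneg T r),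
    inner_self_eq_norm_sq_to_K]
  norm_cast

lemma re_inner_opAbsPow_nonneg (T : H →L[ℂ] H) (r : ℝ) (x : H) :
    0 ≤ (⟪opAbsPow T r x, x⟫_ℂ).re :=
  ((ContinuousLinearMap.nonneg_iff_isPositive _).mp (opAbsPow_nonneg T r)).re_inner_nonneg_left x

lemma re_inner_opAbsPow_rpow_le (T : H →L[ℂ] H) {r t : ℝ} (hr : 0 ≤ r) (ht : 1 ≤ t) {x : H}
    (hx : ‖x‖ = 1) :
    (⟪opAbsPow T r x, x⟫_ℂ).re ^ t ≤ (⟪opAbsPow T (r * t) x, x⟫_ℂ).re := by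
  rw [← opAbsPow_rpow T hr (by linarith)]
  exact re_inner_rpow_le (opAbsPow_nonneg T r) ht hx

theorem stmt11 [Nontrivial H] (T : H →L[ℂ] H) (α β : ℝ) (hα : 0 ≤ α) (hβ : 0 ≤ β)
    (hαβ : 1 ≤ α + β) (s : ℝ) (hs : 1 ≤ s) :
    numRadius (T * opAbsPow T (α + β - 1)) ^ (2 * s) ≤
      (1 / 2 : ℝ) * ‖opAbsPow T (4 * s * α) + opAbsPow (star T) (4 * s * β)‖ -
        (1 / 2 : ℝ) *
          ⨅ x : {x : H // ‖x‖ = 1},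
            ((⟪(opAbsPow T (2 * s * α)) x.1, x.1⟫_ℂ).re -
              (⟪(opAbsPow (star T) (2 * s * β)) x.1, x.1⟫_ℂ).re) ^ 2 := by
  have hs0 : 0 < 2 * s := by linarith
  obtain ⟨x₀, hx₀⟩ := exists_norm_eq H zero_le_one
  have : Nonempty {x : H // ‖x‖ = 1} := ⟨⟨x₀, hx₀⟩⟩
  have hpow (x : {x : H // ‖x‖ = 1}) :
      ‖⟪(T * opAbsPow T (α + β - 1)) x.1, x.1⟫_ℂ‖ ^ (2 * s) ≤
        (1 / 2 : ℝ) * ‖opAbsPow T (4 * s * α) + opAbsPow (star T) (4 * s * β)‖ -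
        (1 / 2 : ℝ) *
          ⨅ x : {x : H // ‖x‖ = 1},
            ((⟪(opAbsPow T (2 * s * α)) x.1, x.1⟫_ℂ).re -
              (⟪(opAbsPow (star T) (2 * s * β)) x.1, x.1⟫_ℂ).re) ^ 2 := by
    have hinf := ciInf_le (f := fun x : {x : H // ‖x‖ = 1} ↦
      ((⟪(opAbsPow T (2 * s * α)) x.1, x.1⟫_ℂ).re -
        (⟪(opAbsPow (star T) (2 * s * β)) x.1, x.1⟫_ℂ).re) ^ 2)
      ⟨0, Set.forall_mem_range.mpr fun _ ↦ sq_nonneg _⟩ x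
    obtain ⟨x, hx⟩ := x
    dsimp only at hinf ⊢
    have hprod : ‖⟪(T * opAbsPow T (α + β - 1)) x, x⟫_ℂ‖ ^ (2 * s) ≤
        (⟪(opAbsPow T (2 * s * α)) x, x⟫_ℂ).re *
          (⟪(opAbsPow (star T) (2 * s * β)) x, x⟫_ℂ).re := by
      have ha := re_inner_opAbsPow_rpow_le T (r := 2 * α) (by positivity) hs hx
      have hb := re_inner_opAbsPow_rpow_le (star T) (r := 2 * β) (by positivity) hs hx
      rw [show 2 * α * s = 2 * s * α by ring, ← norm_opAbsPow_apply_sq T hα] at ha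
      rw [show 2 * β * s = 2 * s * β by ring, ← norm_opAbsPow_apply_sq (star T) hβ] at hb
      rw [Real.rpow_mul (norm_nonneg _), Real.rpow_two]
      calc (‖⟪(T * opAbsPow T (α + β - 1)) x, x⟫_ℂ‖ ^ 2) ^ s
          ≤ ((‖opAbsPow T α x‖ * ‖opAbsPow (star T) β x‖) ^ 2) ^ s := by
            gcongr
            exact norm_inner_mul_opAbsPow_le T hα hβ hαβ x x
        _ = (‖opAbsPow T α x‖ ^ 2) ^ s * (‖opAbsPow (star T) β x‖ ^ 2) ^ s := by
            rw [mul_pow, Real.mul_rpow (sq_nonneg _) (sq_nonneg _)]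
        _ ≤ _ := mul_le_mul ha hb (by positivity) (re_inner_opAbsPow_nonneg _ _ _)
    have ha2 := re_inner_opAbsPow_rpow_le T (r := 2 * s * α) (by positivity) one_le_two hx
    have hb2 := re_inner_opAbsPow_rpow_le (star T) (r := 2 * s * β) (by positivity) one_le_two hx
    rw [show 2 * s * α * 2 = 4 * s * α by ring, Real.rpow_two] at ha2
    rw [show 2 * s * β * 2 = 4 * s * β by ring, Real.rpow_two] at hb2
    have hnorm : (⟪opAbsPow T (4 * s * α) x, x⟫_ℂ).re +
        (⟪opAbsPow (star T) (4 * s * β) x, x⟫_ℂ).re ≤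
        ‖opAbsPow T (4 * s * α) + opAbsPow (star T) (4 * s * β)‖ := by
      rw [← Complex.add_re, ← inner_add_left, ← add_apply]
      refine (Complex.re_le_norm _).trans ((norm_inner_le_norm _ _).trans ?_)
      rw [hx, mul_one]
      exact ContinuousLinearMap.unit_le_opNorm _ _ hx.le
    nlinarith
  have hC := (Real.rpow_nonneg (norm_nonneg _) _).trans (hpow ⟨x₀, hx₀⟩)
  have hw : 0 ≤ numRadius (T * opAbsPow T (α + β - 1)) :=
    Real.iSup_nonneg fun _ ↦ norm_nonneg _
  rw [← Real.le_rpow_inv_iff_of_pos hw hC hs0]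
  exact ciSup_le fun x ↦ (Real.le_rpow_inv_iff_of_pos (norm_nonneg _) hC hs0).mpr (hpow x)
end

section
/- Let T be a bounded linear operator on a nontrivial complex Hilbert space H. Then w²(T|T|) ≤ (1/2) ‖ |T|⁴ + |T*|⁴ ‖ − (1/2) · inf_{‖x‖=1} ( ⟨|T|²x, x⟩ − ⟨|T*|²x, x⟩ )². -/
open scoped InnerProductSpace NNReal

variable {H : Type*} [NormedAddCommGroup H] [InnerProductSpace ℂ H] [CompleteSpace H]

lemma opAbs_sq (T : H →L[ℂ] H) : opAbs T ^ 2 = star T * T :=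
  CFC.sq_sqrt (star T * T) (star_mul_self_nonneg T)

lemma isSelfAdjoint_opAbs (T : H →L[ℂ] H) : IsSelfAdjoint (opAbs T) :=
  IsSelfAdjoint.of_nonneg (CFC.sqrt_nonneg _)

lemma inner_mul_apply_left (A B : H →L[ℂ] H) (x y : H) :
    ⟪(A * B) x, y⟫_ℂ = ⟪B x, star A y⟫_ℂ := by
  rw [ContinuousLinearMap.star_eq_adjoint, ContinuousLinearMap.adjoint_inner_right]
  rfl

lemma re_inner_star_mul_self_apply (A : H →L[ℂ] H) (x : H) :
    (⟪(star A * A) x, x⟫_ℂ).re = ‖A x‖ ^ 2 := by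
  rw [inner_mul_apply_left, star_star]
  exact inner_self_eq_norm_sq (𝕜 := ℂ) (A x)

lemma norm_opAbs_apply (T : H →L[ℂ] H) (x : H) : ‖opAbs T x‖ = ‖T x‖ := by
  have h := re_inner_star_mul_self_apply (opAbs T) x
  rw [(isSelfAdjoint_opAbs T).star_eq, ← sq, opAbs_sq, re_inner_star_mul_self_apply] at h
  exact ((sq_eq_sq₀ (norm_nonneg _) (norm_nonneg _)).mp h).symm

lemma sq_re_inner_opAbs_sq_le (T : H →L[ℂ] H) {x : H} (hx : ‖x‖ = 1) :
    (⟪(opAbs T ^ 2) x, x⟫_ℂ).re ^ 2 ≤ (⟪(opAbs T ^ 4) x, x⟫_ℂ).re := by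
  have h4 : opAbs T ^ 4 = star (opAbs T ^ 2) * opAbs T ^ 2 := by
    rw [((isSelfAdjoint_opAbs T).pow 2).star_eq, ← pow_add]
  rw [h4, re_inner_star_mul_self_apply]
  refine sq_le_sq.mpr ?_
  rw [abs_of_nonneg (norm_nonneg _)]
  calc _ ≤ ‖⟪(opAbs T ^ 2) x, x⟫_ℂ‖ := Complex.abs_re_le_norm _
    _ ≤ ‖(opAbs T ^ 2) x‖ * ‖x‖ := norm_inner_le_norm _ _
    _ = _ := by rw [hx, mul_one]

set_option linter.unusedSectionVars false in
lemma re_inner_apply_le_opNorm (A : H →L[ℂ] H) {x : H} (hx : ‖x‖ = 1) :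
    (⟪A x, x⟫_ℂ).re ≤ ‖A‖ :=
  calc _ ≤ ‖⟪A x, x⟫_ℂ‖ := Complex.re_le_norm _
    _ ≤ ‖A x‖ * ‖x‖ := norm_inner_le_norm _ _
    _ ≤ ‖A‖ := by simpa [hx] using A.le_opNorm x

lemma norm_inner_mul_opAbs_sq_le (T : H →L[ℂ] H) (x : H) :
    ‖⟪(T * opAbs T) x, x⟫_ℂ‖ ^ 2 ≤
      (⟪(opAbs T ^ 2) x, x⟫_ℂ).re * (⟪(opAbs (star T) ^ 2) x, x⟫_ℂ).re := by
  rw [opAbs_sq, opAbs_sq, re_inner_star_mul_self_apply, re_inner_star_mul_self_apply,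
    inner_mul_apply_left, ← mul_pow, ← norm_opAbs_apply T]
  gcongr
  exact norm_inner_le_norm _ _

theorem stmt14 [Nontrivial H] (T : H →L[ℂ] H) :
    numRadius (T * opAbs T) ^ 2 ≤
      (1 / 2 : ℝ) * ‖opAbs T ^ 4 + opAbs (star T) ^ 4‖ -
        (1 / 2 : ℝ) *
          ⨅ x : {x : H // ‖x‖ = 1},
            ((⟪(opAbs T ^ 2) x.1, x.1⟫_ℂ).re - (⟪(opAbs (star T) ^ 2) x.1, x.1⟫_ℂ).re) ^ 2 := by
  set R := (1 / 2 : ℝ) * ‖opAbs T ^ 4 + opAbs (star T) ^ 4‖ -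
        (1 / 2 : ℝ) *
          ⨅ x : {x : H // ‖x‖ = 1},
            ((⟪(opAbs T ^ 2) x.1, x.1⟫_ℂ).re - (⟪(opAbs (star T) ^ 2) x.1, x.1⟫_ℂ).re) ^ 2
    with hR
  have key : ∀ x : {x : H // ‖x‖ = 1}, ‖⟪(T * opAbs T) x.1, x.1⟫_ℂ‖ ^ 2 ≤ R := by
    intro x
    have hinf := ciInf_le (f := fun x : {x : H // ‖x‖ = 1} =>
      ((⟪(opAbs T ^ 2) x.1, x.1⟫_ℂ).re - (⟪(opAbs (star T) ^ 2) x.1, x.1⟫_ℂ).re) ^ 2)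
      ⟨0, by rintro _ ⟨y, rfl⟩; exact sq_nonneg _⟩ x
    have hprod := norm_inner_mul_opAbs_sq_le T x.1
    have h₁ := sq_re_inner_opAbs_sq_le T x.2
    have h₂ := sq_re_inner_opAbs_sq_le (star T) x.2
    have hnorm := re_inner_apply_le_opNorm (opAbs T ^ 4 + opAbs (star T) ^ 4) x.2
    rw [add_apply, inner_add_left, Complex.add_re] at hnorm
    nlinarith
  obtain ⟨x₀, hx₀⟩ := exists_norm_eq H zero_le_one
  have : Nonempty {x : H // ‖x‖ = 1} := ⟨⟨x₀, hx₀⟩⟩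
  have hR0 : 0 ≤ R := (sq_nonneg _).trans (key ⟨x₀, hx₀⟩)
  have hsup : numRadius (T * opAbs T) ≤ √R :=
    ciSup_le fun x => Real.le_sqrt_of_sq_le (key x)
  have hpos : 0 ≤ numRadius (T * opAbs T) := Real.iSup_nonneg fun _ => norm_nonneg _
  exact (Real.le_sqrt hpos hR0).mp hsup
end
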